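/- Let d ≥ 3 and f : V(T_d) → ℝ_{≥0} nonzero with α(f) = limsup_t a_t(f)^{1/t} < ∞, where a_t(f) is the sum of f over endpoints of non-backtracking walks of length t from the root o, and b_t(f) the analogous sum over all walks of length t. Then limsup_t b_t(f)^{1/t} = g_d(α(f)) with g_d(α) = 2√(d−1) for α ≤ √(d−1) and g_d(α) = α + (d−1)/α for α ≥ √(d−1). -/

import Mathlib

open Filter Topology

/-- In the `(q + 1)`-regular tree, the number of walks of length `t` from the root to a fixed
vertex at distance `k` from it. -/
def treeWalkCount (q : ℝ) : ℕ → ℕ → ℝ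
  | 0, 0 => 1
  | 0, _ + 1 => 0
  | t + 1, 0 => (q + 1) * treeWalkCount q t 1
  | t + 1, k + 1 => treeWalkCount q t k + q * treeWalkCount q t (k + 2)

namespace treeWalkCount

variable {q : ℝ}

theorem nonneg (hq : 0 ≤ q) (t k : ℕ) : 0 ≤ treeWalkCount q t k := by
  induction t generalizing k with
  | zero => cases k <;> simp [treeWalkCount]
  | succ t ih =>
    cases k with
    | zero => simpa [treeWalkCount] using mul_nonneg (by linarith) (ih 1)
    | succ k => simpa [treeWalkCount] using add_nonneg (ih k) (mul_nonneg hq (ih (k + 2)))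

theorem eq_zero_of_lt (q : ℝ) {t k : ℕ} (h : t < k) : treeWalkCount q t k = 0 := by
  induction t generalizing k with
  | zero => cases k <;> simp_all [treeWalkCount]
  | succ t ih =>
    cases k with
    | zero => omega
    | succ k => simp [treeWalkCount, ih (show t < k by omega), ih (show t < k + 2 by omega)]

theorem self (q : ℝ) (t : ℕ) : treeWalkCount q t t = 1 := by
  induction t with
  | zero => simp [treeWalkCount]
  | succ t ih => simp [treeWalkCount, ih, eq_zero_of_lt q (show t < t + 2 by omega)]

theorem le_pow_div_pow (hq : 0 ≤ q) {l : ℝ} (hl : 1 ≤ l) (t k : ℕ) :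
    treeWalkCount q t k ≤ (l + q / l) ^ t / l ^ k := by
  have hl0 : 0 < l := by linarith
  have hy : 0 ≤ l + q / l := by positivity
  induction t generalizing k with
  | zero =>
    cases k with
    | zero => simp [treeWalkCount]
    | succ k => simp only [treeWalkCount]; positivity
  | succ t ih =>
    cases k with
    | zero =>
      calc (q + 1) * treeWalkCount q t 1 ≤ (q + 1) * ((l + q / l) ^ t / l ^ 1) := by
            gcongr; exact ih 1
        _ = (l + q / l) ^ t * (1 / l + q / l) := by ring
        _ ≤ (l + q / l) ^ t * (l + q / l) := by
            gcongr
            rw [div_le_iff₀ hl0]; nlinarith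
        _ = _ := by ring
    | succ k =>
      calc treeWalkCount q t k + q * treeWalkCount q t (k + 2)
          ≤ (l + q / l) ^ t / l ^ k + q * ((l + q / l) ^ t / l ^ (k + 2)) := by
            gcongr
            exacts [ih k, ih (k + 2)]
        _ = _ := by
            rw [pow_succ (l + q / l)]
            field_simp
            ring

theorem summable_succ_div (y : ℝ) {k : ℕ} (hy : 0 < y)
    (h : Summable fun t ↦ treeWalkCount q t k / y ^ t) :
    Summable fun t ↦ treeWalkCount q (t + 1) k / y ^ t := by
  refine (((summable_nat_add_iff 1).2 h).mul_left y).congr fun t ↦ ?_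
  field_simp
  ring

theorem tsum_zero {y : ℝ} (hy : 0 < y) (h : ∀ k, Summable fun t ↦ treeWalkCount q t k / y ^ t) :
    ∑' t, treeWalkCount q t 0 / y ^ t =
      1 + (q + 1) / y * ∑' t, treeWalkCount q t 1 / y ^ t := by
  rw [(h 0).tsum_eq_zero_add, ← tsum_mul_left]
  congr 1
  · simp [treeWalkCount]
  · refine tsum_congr fun t ↦ ?_
    simp only [treeWalkCount]
    field_simp
    ring

theorem mul_tsum_succ {y : ℝ} (hy : 0 < y)
    (h : ∀ k, Summable fun t ↦ treeWalkCount q t k / y ^ t) (k : ℕ) :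
    y * ∑' t, treeWalkCount q t (k + 1) / y ^ t =
      ∑' t, treeWalkCount q t k / y ^ t + q * ∑' t, treeWalkCount q t (k + 2) / y ^ t := by
  rw [(h (k + 1)).tsum_eq_zero_add, ← tsum_mul_left, ← (h k).tsum_add ((h (k + 2)).mul_left q),
    mul_add, ← tsum_mul_left]
  simp only [treeWalkCount, zero_div, mul_zero, zero_add]
  refine tsum_congr fun t ↦ ?_
  field_simp
  ring

theorem summable_neighbors (hq : 1 < q) {y : ℝ} (hy : 0 < y) {k : ℕ}
    (h : Summable fun t ↦ treeWalkCount q t k / y ^ t) (j : ℕ) :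
    Summable fun t ↦ treeWalkCount q t j / y ^ t := by
  have hn : ∀ t k, 0 ≤ treeWalkCount q t k := nonneg (by linarith)
  have up : ∀ k, (Summable fun t ↦ treeWalkCount q t k / y ^ t) →
      Summable fun t ↦ treeWalkCount q t (k + 1) / y ^ t := by
    intro k hk
    refine (summable_succ_div y hy hk).of_nonneg_of_le (fun t ↦ div_nonneg (hn _ _) (by positivity))
      fun t ↦ ?_
    gcongr
    cases k with
    | zero => simp only [treeWalkCount]; nlinarith [hn t 1]
    | succ k => simp only [treeWalkCount]; nlinarith [hn t k, hn t (k + 2)]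
  have down : ∀ k, (Summable fun t ↦ treeWalkCount q t (k + 1) / y ^ t) →
      Summable fun t ↦ treeWalkCount q t k / y ^ t := by
    intro k hk
    refine (summable_succ_div y hy hk).of_nonneg_of_le (fun t ↦ div_nonneg (hn _ _) (by positivity))
      fun t ↦ ?_
    gcongr
    simp only [treeWalkCount]; nlinarith [hn t (k + 2)]
  have h0 : Summable fun t ↦ treeWalkCount q t 0 / y ^ t := by
    induction k with
    | zero => exact h
    | succ k ih => exact ih (down k h)
  induction j with
  | zero => exact h0
  | succ j ih => exact up j ih

end treeWalkCount

theorem le_of_geometric_increments {W : ℕ → ℝ} (hW : ∀ k, 0 ≤ W k) {r : ℝ} (hr : 1 ≤ r)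
    (h : ∀ k, W (k + 2) - W (k + 1) = r * (W (k + 1) - W k)) (k : ℕ) : W 0 ≤ W k := by
  have hD : 0 ≤ W 1 - W 0 := by
    by_contra! hD
    have hle : ∀ k, W (k + 1) - W k ≤ W 1 - W 0 := by
      intro k
      induction k with
      | zero => simp
      | succ k ih => rw [h k]; nlinarith
    have hlin : ∀ k : ℕ, W k ≤ W 0 + k * (W 1 - W 0) := by
      intro k
      induction k with
      | zero => simp
      | succ k ih => push_cast; linarith [hle k]
    obtain ⟨n, hn⟩ := exists_nat_gt (W 0 / (W 0 - W 1))
    rw [div_lt_iff₀ (by linarith)] at hn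
    linarith [hlin n, hW n]
  have hinc : ∀ k, 0 ≤ W (k + 1) - W k := by
    intro k
    induction k with
    | zero => exact hD
    | succ k ih => rw [h k]; positivity
  exact monotone_nat_of_le_succ (fun k ↦ by linarith [hinc k]) (Nat.zero_le k)

theorem not_forall_pos_of_recurrence {G : ℕ → ℝ} (hG : ∀ k, 0 < G k) {q y : ℝ} (hq : 0 < q)
    (hy : y < 2 * √q) (h : ∀ k, y * G (k + 1) = G k + q * G (k + 2)) : False := by
  have hs : 0 < √q := Real.sqrt_pos.2 hq
  have hsq : √q * √q = q := Real.mul_self_sqrt hq.le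
  have hr : ∀ k, 0 < G (k + 1) / G k := fun k ↦ div_pos (hG _) (hG _)
  have step : ∀ k, G (k + 2) / G (k + 1) ≤ G (k + 1) / G k - (2 * √q - y) / q := by
    intro k
    have h0 := hG k
    have h1 := hG (k + 1)
    have e : G (k + 2) = (y * G (k + 1) - G k) / q := by rw [h k]; field_simp; ring
    have : G (k + 1) / G k - (2 * √q - y) / q - G (k + 2) / G (k + 1)
        = (√q * G (k + 1) - G k) ^ 2 / (q * G k * G (k + 1)) := by
      rw [e]
      field_simp
      linear_combination (-G (k + 1) ^ 2) * hsq
    have : 0 ≤ (√q * G (k + 1) - G k) ^ 2 / (q * G k * G (k + 1)) := by positivity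
    linarith
  have hδ : 0 < (2 * √q - y) / q := div_pos (by linarith) hq
  have hlin : ∀ k : ℕ, G (k + 1) / G k ≤ G 1 / G 0 - k * ((2 * √q - y) / q) := by
    intro k
    induction k with
    | zero => simp
    | succ k ih => push_cast; linarith [step k]
  obtain ⟨n, hn⟩ := exists_nat_gt (G 1 / G 0 / ((2 * √q - y) / q))
  rw [div_lt_iff₀ hδ] at hn
  linarith [hlin n, hr n]

namespace treeWalkCount

variable {q : ℝ}

theorem not_summable (hq : 1 < q) {y : ℝ} (hy : 0 < y) (hyq : y < 2 * √q) (k : ℕ) :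
    ¬ Summable fun t ↦ treeWalkCount q t k / y ^ t := by
  intro h
  have hs := summable_neighbors hq hy h
  refine not_forall_pos_of_recurrence (q := q)
    (G := fun k ↦ ∑' t, treeWalkCount q t k / y ^ t) (fun k ↦ ?_) (by linarith) hyq
    (mul_tsum_succ hy hs)
  refine (hs k).tsum_pos (fun t ↦ div_nonneg (nonneg (by linarith) t k) (by positivity)) k ?_
  rw [self]
  positivity

theorem one_div_pow_le_tsum (hq : 1 < q) {l : ℝ} (hl : √q < l)
    (hs : ∀ k, Summable fun t ↦ treeWalkCount q t k / (l + q / l) ^ t) (k : ℕ) :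
    1 / l ^ k ≤ ∑' t, treeWalkCount q t k / (l + q / l) ^ t := by
  have hl0 : 0 < l := (Real.sqrt_nonneg q).trans_lt hl
  have hql : q < l ^ 2 := (Real.sqrt_lt' hl0).1 hl
  have hy : 0 < l + q / l := by positivity
  have hG : ∀ k, 0 ≤ ∑' t, treeWalkCount q t k / (l + q / l) ^ t := fun k ↦
    tsum_nonneg fun t ↦ div_nonneg (nonneg (by linarith) t k) (by positivity)
  have hrec := mul_tsum_succ hy hs
  have h0 := tsum_zero hy hs
  set G : ℕ → ℝ := fun k ↦ ∑' t, treeWalkCount q t k / (l + q / l) ^ t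
  change ∀ k, 0 ≤ G k at hG
  change ∀ k, (l + q / l) * G (k + 1) = G k + q * G (k + 2) at hrec
  change G 0 = 1 + (q + 1) / (l + q / l) * G 1 at h0
  change 1 / l ^ k ≤ G k
  have hmono := le_of_geometric_increments (W := fun k ↦ l ^ k * G k) (r := l ^ 2 / q)
    (fun k ↦ mul_nonneg (by positivity) (hG k)) (by rw [le_div_iff₀ (by linarith)]; linarith)
    (fun k ↦ by
      have h := hrec k
      field_simp at h ⊢
      linear_combination (-l ^ (k + 1)) * h) k
  have : 0 ≤ (q + 1) / (l + q / l) * G 1 := mul_nonneg (by positivity) (hG 1)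
  rw [div_le_iff₀ (by positivity)]
  simp only [pow_zero, one_mul] at hmono
  linarith

end treeWalkCount

theorem tendsto_linear_mul_pow_rpow_inv {C y : ℝ} (hC : 0 < C) (hy : 0 ≤ y) :
    Tendsto (fun t : ℕ ↦ (C * t * y ^ t) ^ ((1 : ℝ) / t)) atTop (𝓝 y) := by
  have h1 : Tendsto (fun t : ℕ ↦ C ^ ((1 : ℝ) / t)) atTop (𝓝 1) := by
    simpa [Function.comp_def] using ((Real.continuous_const_rpow hC.ne').tendsto 0).comp
      (tendsto_one_div_atTop_nhds_zero_nat (𝕜 := ℝ))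
  have h2 : Tendsto (fun t : ℕ ↦ (t : ℝ) ^ ((1 : ℝ) / t)) atTop (𝓝 1) :=
    tendsto_rpow_div.comp tendsto_natCast_atTop_atTop
  have h3 := (h1.mul h2).mul_const y
  rw [one_mul, one_mul] at h3
  refine h3.congr' ?_
  filter_upwards [eventually_ge_atTop 1] with t ht
  rw [Real.mul_rpow (by positivity) (by positivity), Real.mul_rpow hC.le (by positivity), one_div,
    Real.pow_rpow_inv_natCast hy (by omega)]

theorem eventually_rpow_inv_le {u : ℕ → ℝ} (hu : ∀ t, 0 ≤ u t) {C y : ℝ} (hC : 0 < C)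
    (h : ∀ t, u t ≤ C * (t + 1) * y ^ t) (hy : 0 ≤ y) :
    ∀ᶠ t : ℕ in atTop, (u t) ^ ((1 : ℝ) / t) ≤ (2 * C * t * y ^ t) ^ ((1 : ℝ) / t) := by
  filter_upwards [eventually_ge_atTop 1] with t ht
  refine Real.rpow_le_rpow (hu t) ((h t).trans ?_) (by positivity)
  have : (1 : ℝ) ≤ t := by exact_mod_cast ht
  gcongr ?_ * _
  nlinarith

theorem isBoundedUnder_rpow_inv {u : ℕ → ℝ} (hu : ∀ t, 0 ≤ u t) {C y : ℝ} (hC : 0 < C)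
    (h : ∀ t, u t ≤ C * (t + 1) * y ^ t) (hy : 0 ≤ y) :
    IsBoundedUnder (· ≤ ·) atTop (fun t : ℕ ↦ (u t) ^ ((1 : ℝ) / t)) :=
  (tendsto_linear_mul_pow_rpow_inv (by positivity) hy).isBoundedUnder_le.mono_le
    (eventually_rpow_inv_le hu hC h hy)

theorem isCoboundedUnder_rpow_inv {u : ℕ → ℝ} (hu : ∀ t, 0 ≤ u t) :
    IsCoboundedUnder (· ≤ ·) atTop (fun t : ℕ ↦ (u t) ^ ((1 : ℝ) / t)) :=
  (isBoundedUnder_of ⟨0, fun t ↦ Real.rpow_nonneg (hu t) _⟩ :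
    IsBoundedUnder (· ≥ ·) atTop _).isCoboundedUnder_le

theorem limsup_rpow_inv_le {u : ℕ → ℝ} (hu : ∀ t, 0 ≤ u t) {C y : ℝ} (hC : 0 < C)
    (h : ∀ t, u t ≤ C * (t + 1) * y ^ t) (hy : 0 ≤ y) :
    limsup (fun t : ℕ ↦ (u t) ^ ((1 : ℝ) / t)) atTop ≤ y := by
  have hlim := tendsto_linear_mul_pow_rpow_inv (C := 2 * C) (by positivity) hy
  rw [← hlim.limsup_eq]
  exact limsup_le_limsup (eventually_rpow_inv_le hu hC h hy) (isCoboundedUnder_rpow_inv hu)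
    hlim.isBoundedUnder_le

theorem exists_le_mul_pow_of_limsup_lt {u : ℕ → ℝ} (hu : ∀ t, 0 ≤ u t)
    (hb : IsBoundedUnder (· ≤ ·) atTop (fun t : ℕ ↦ (u t) ^ ((1 : ℝ) / t))) {y : ℝ} (hy : 0 < y)
    (h : limsup (fun t : ℕ ↦ (u t) ^ ((1 : ℝ) / t)) atTop < y) :
    ∃ C > 0, ∀ t, u t ≤ C * y ^ t := by
  obtain ⟨n, hn⟩ := eventually_atTop.1 (eventually_lt_of_limsup_lt h hb)
  have hS : ∀ t, 0 ≤ u t / y ^ t := fun t ↦ div_nonneg (hu t) (by positivity)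
  refine ⟨1 + ∑ t ∈ Finset.range (n + 1), u t / y ^ t,
    add_pos_of_pos_of_nonneg one_pos (Finset.sum_nonneg fun t _ ↦ hS t), fun t ↦ ?_⟩
  rw [← div_le_iff₀ (by positivity)]
  by_cases ht : t < n + 1
  · have := Finset.single_le_sum (f := fun t ↦ u t / y ^ t) (fun t _ ↦ hS t)
      (Finset.mem_range.2 ht)
    linarith
  · have h1 : u t ≤ y ^ t := by
      have h2 := pow_le_pow_left₀ (Real.rpow_nonneg (hu t) _) (hn t (by omega)).le t
      rwa [one_div, Real.rpow_inv_natCast_pow (hu t) (by omega)] at h2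
    have h3 : u t / y ^ t ≤ 1 := div_le_one_of_le₀ h1 (by positivity)
    have h4 := Finset.sum_nonneg fun t (_ : t ∈ Finset.range (n + 1)) ↦ hS t
    linarith

theorem summable_div_pow_of_limsup_lt {u : ℕ → ℝ} (hu : ∀ t, 0 ≤ u t)
    (hb : IsBoundedUnder (· ≤ ·) atTop (fun t : ℕ ↦ (u t) ^ ((1 : ℝ) / t))) {y : ℝ} (hy : 0 < y)
    (h : limsup (fun t : ℕ ↦ (u t) ^ ((1 : ℝ) / t)) atTop < y) :
    Summable fun t ↦ u t / y ^ t := by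
  obtain ⟨x, hx, hxy⟩ := exists_between (max_lt h hy)
  obtain ⟨hx, hx0⟩ := max_lt_iff.1 hx
  obtain ⟨C, -, hC⟩ := exists_le_mul_pow_of_limsup_lt hu hb hx0 hx
  refine ((summable_geometric_of_lt_one (by positivity)
    ((div_lt_one hy).2 hxy)).mul_left C).of_nonneg_of_le
    (fun t ↦ div_nonneg (hu t) (by positivity)) fun t ↦ ?_
  rw [div_pow, ← mul_div_assoc]
  gcongr
  exact hC t

/-- The extended cogrowth formula for sequences related by
`b t = ∑ k ≤ t, treeWalkCount q t k * a k`. -/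
theorem limsup_rpow_inv_of_eq_sum_treeWalkCount {q : ℝ} (hq : 1 < q) {a b : ℕ → ℝ}
    (ha : ∀ t, 0 ≤ a t) {k₀ : ℕ} (hk₀ : 0 < a k₀)
    (hab : ∀ t, b t = ∑ k ∈ Finset.range (t + 1), treeWalkCount q t k * a k)
    (hbdd : IsBoundedUnder (· ≤ ·) atTop (fun t : ℕ ↦ (a t) ^ ((1 : ℝ) / t))) {α : ℝ}
    (hα : α = limsup (fun t : ℕ ↦ (a t) ^ ((1 : ℝ) / t)) atTop) :
    limsup (fun t : ℕ ↦ (b t) ^ ((1 : ℝ) / t)) atTop =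
      if α ≤ √q then 2 * √q else α + q / α := by
  have hn : ∀ t k, 0 ≤ treeWalkCount q t k := treeWalkCount.nonneg (by linarith)
  have hsq1 : 1 < √q := Real.lt_sqrt_of_sq_lt (by linarith)
  have hb : ∀ t, 0 ≤ b t := fun t ↦ by
    rw [hab]; exact Finset.sum_nonneg fun k _ ↦ mul_nonneg (hn t k) (ha k)
  have hle : ∀ t k, treeWalkCount q t k * a k ≤ b t := by
    intro t k
    by_cases h : k < t + 1
    · rw [hab]
      exact Finset.single_le_sum (f := fun k ↦ treeWalkCount q t k * a k)
        (fun k _ ↦ mul_nonneg (hn t k) (ha k)) (Finset.mem_range.2 h)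
    · rw [treeWalkCount.eq_zero_of_lt q (by omega), zero_mul]; exact hb t
  have hupper : ∀ l, max α (√q) < l → ∃ C > 0, ∀ t, b t ≤ C * (t + 1) * (l + q / l) ^ t := by
    intro l hl
    obtain ⟨hl1, hl2⟩ := max_lt_iff.1 hl
    have hl0 : 0 < l := by linarith
    obtain ⟨C, hC, h⟩ := exists_le_mul_pow_of_limsup_lt ha hbdd hl0 (hα ▸ hl1)
    refine ⟨C, hC, fun t ↦ ?_⟩
    calc b t ≤ ∑ k ∈ Finset.range (t + 1), C * (l + q / l) ^ t := by
          rw [hab]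
          refine Finset.sum_le_sum fun k _ ↦ ?_
          calc treeWalkCount q t k * a k ≤ (l + q / l) ^ t / l ^ k * (C * l ^ k) :=
                mul_le_mul (treeWalkCount.le_pow_div_pow (by linarith) (by linarith) t k) (h k)
                  (ha k) (by positivity)
            _ = C * (l + q / l) ^ t := by field_simp
      _ = C * (t + 1) * (l + q / l) ^ t := by simp; ring
  have hbb : IsBoundedUnder (· ≤ ·) atTop (fun t : ℕ ↦ (b t) ^ ((1 : ℝ) / t)) := by
    obtain ⟨C, hC, h⟩ := hupper (max α (√q) + 1) (by linarith)
    have : 0 < max α (√q) := lt_max_of_lt_right (by linarith)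
    exact isBoundedUnder_rpow_inv hb hC h (by positivity)
  have hcont : ∀ x : ℝ, 0 < x → ContinuousAt (fun l ↦ l + q / l) x := fun x hx ↦
    continuousAt_id.add (continuousAt_const.div continuousAt_id hx.ne')
  have hle_max : limsup (fun t : ℕ ↦ (b t) ^ ((1 : ℝ) / t)) atTop ≤
      max α (√q) + q / max α (√q) := by
    have h0 : 0 < max α (√q) := lt_max_of_lt_right (by linarith)
    refine ge_of_tendsto ((hcont _ h0).tendsto.mono_left
      (nhdsWithin_le_nhds (s := Set.Ioi (max α (√q))))) ?_
    filter_upwards [self_mem_nhdsWithin] with l hl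
    obtain ⟨C, hC, h⟩ := hupper l hl
    have : 0 < l := h0.trans hl
    exact limsup_rpow_inv_le hb hC h (by positivity)
  split_ifs with hc
  · refine le_antisymm ?_ ?_
    · rw [max_eq_right hc, Real.div_sqrt] at hle_max
      linarith
    · by_contra! hlt
      obtain ⟨y, hy, hyq⟩ := exists_between (max_lt hlt (by positivity : 0 < 2 * √q))
      obtain ⟨hy, hy0⟩ := max_lt_iff.1 hy
      refine treeWalkCount.not_summable hq hy0 hyq k₀ ?_
      refine ((summable_div_pow_of_limsup_lt hb hbb hy0 hy).div_const (a k₀)).of_nonneg_of_le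
        (fun t ↦ div_nonneg (hn t _) (by positivity)) fun t ↦ ?_
      rw [le_div_iff₀ hk₀, div_mul_eq_mul_div]
      gcongr
      exact hle t k₀
  · push Not at hc
    have hα0 : 0 < α := by linarith
    refine le_antisymm (by rwa [max_eq_left hc.le] at hle_max) ?_
    refine le_of_tendsto ((hcont _ hα0).tendsto.mono_left (nhdsWithin_le_nhds (s := Set.Iio α))) ?_
    filter_upwards [Ioo_mem_nhdsLT hc] with l hl
    obtain ⟨hl1, hl2⟩ := hl
    have hl0 : 0 < l := by linarith
    have hy : 0 < l + q / l := by positivity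
    by_contra! hlt
    have hsum := summable_div_pow_of_limsup_lt hb hbb hy hlt
    have hdom : ∀ t k, treeWalkCount q t k / (l + q / l) ^ t * a k ≤ b t / (l + q / l) ^ t := by
      intro t k
      rw [div_mul_eq_mul_div]
      gcongr
      exact hle t k
    have hs := treeWalkCount.summable_neighbors hq hy (k := k₀)
      ((hsum.div_const (a k₀)).of_nonneg_of_le
        (fun t ↦ div_nonneg (hn t _) (by positivity)) fun t ↦ by
          rw [le_div_iff₀ hk₀]; exact hdom t k₀)
    have hak : ∀ k, a k ≤ (∑' t, b t / (l + q / l) ^ t) * l ^ k := by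
      intro k
      have h1 := mul_le_mul_of_nonneg_right (treeWalkCount.one_div_pow_le_tsum hq hl1 hs k) (ha k)
      rw [← tsum_mul_right] at h1
      have h2 := h1.trans (((hs k).mul_right (a k)).tsum_le_tsum (fun t ↦ hdom t k) hsum)
      rwa [one_div_mul_eq_div, div_le_iff₀ (by positivity)] at h2
    have hC : 0 < ∑' t, b t / (l + q / l) ^ t := by
      have := hk₀.trans_le (hak k₀)
      exact pos_of_mul_pos_left this (by positivity)
    have := limsup_rpow_inv_le ha hC (fun k ↦ (hak k).trans ?_) hl0.le
    · linarith
    · have : (0 : ℝ) ≤ k := by positivity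
      gcongr ?_ * _
      nlinarith

namespace SimpleGraph

variable {V : Type*} (G : SimpleGraph V)

/-- A walk of length `t + 1` from `u` is a neighbor `w` of `u` and a walk of length `t` from `w`. -/
def walkLengthSuccEquiv (u : V) (t : ℕ) :
    {q : Σ v : V, G.Walk u v // q.2.length = t + 1} ≃
      Σ w : G.neighborSet u, {q : Σ v : V, G.Walk w v // q.2.length = t} where
  toFun
    | ⟨⟨_, .nil⟩, h⟩ => absurd h (by simp)
    | ⟨⟨v, .cons (v := w) hadj p⟩, h⟩ => ⟨⟨w, hadj⟩, ⟨⟨v, p⟩, by simpa using h⟩⟩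
  invFun x := ⟨⟨x.2.1.1, .cons x.1.2 x.2.1.2⟩, congrArg (· + 1) x.2.2⟩
  left_inv
    | ⟨⟨_, .nil⟩, h⟩ => absurd h (by simp)
    | ⟨⟨_, .cons _ _⟩, _⟩ => rfl
  right_inv _ := rfl

theorem finite_walk_length_eq [G.LocallyFinite] (t : ℕ) (u : V) :
    Finite {q : Σ v : V, G.Walk u v // q.2.length = t} := by
  induction t generalizing u with
  | zero =>
    refine @Finite.of_subsingleton _ ⟨?_⟩
    rintro ⟨⟨_, _ | _⟩, hp⟩ ⟨⟨_, _ | _⟩, hq⟩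
    · rfl
    all_goals simp at hp hq
  | succ t ih => exact Finite.of_equiv _ (G.walkLengthSuccEquiv u t).symm

/-- The adjacency operator: sum of a function over the neighbors of a vertex. -/
def neighborSum [G.LocallyFinite] (f : V → ℝ) (u : V) : ℝ := ∑ w ∈ G.neighborFinset u, f w

theorem tsum_walk_length_eq [G.LocallyFinite] (f : V → ℝ) (t : ℕ) (u : V) :
    ∑' q : {q : Σ v : V, G.Walk u v // q.2.length = t}, f q.1.1 = G.neighborSum^[t] f u := by
  induction t generalizing u with
  | zero =>
    rw [tsum_eq_single ⟨⟨u, .nil⟩, rfl⟩]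
    · rfl
    · rintro ⟨⟨_, _ | _⟩, hp⟩ hne
      · exact absurd rfl hne
      · simp at hp
  | succ t ih =>
    have := G.finite_walk_length_eq t
    rw [← (G.walkLengthSuccEquiv u t).symm.tsum_eq, Function.iterate_succ_apply', neighborSum]
    change ∑' x : Σ w : G.neighborSet u, {q : Σ v : V, G.Walk w v // q.2.length = t},
      f x.2.1.1 = _
    rw [Summable.tsum_sigma (Summable.of_finite), tsum_fintype, neighborFinset,
      ← Finset.sum_set_coe (G.neighborSet u)]
    exact Finset.sum_congr rfl fun w _ ↦ ih w

theorem finite_dist_eq [G.LocallyFinite] (hG : G.Connected) (o : V) (t : ℕ) :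
    {v | G.dist o v = t}.Finite := by
  have := G.finite_walk_length_eq t o
  refine (Set.finite_range
    fun q : {q : Σ v : V, G.Walk o v // q.2.length = t} ↦ q.1.1).subset ?_
  rintro v rfl
  obtain ⟨p, hp⟩ := hG.exists_walk_length_eq_dist o v
  exact ⟨⟨⟨v, p⟩, hp⟩, rfl⟩

variable {G}

theorem IsTree.length_eq_dist (hG : G.IsTree) {u v : V} {p : G.Walk u v} (hp : p.IsPath) :
    p.length = G.dist u v := by
  obtain ⟨q, hq, hqd⟩ := hG.connected.exists_path_of_dist u v
  rw [(hG.existsUnique_path u v).unique hp hq, hqd]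

theorem IsTree.tsum_path_length_eq (hG : G.IsTree) (o : V) (f : V → ℝ) (t : ℕ) :
    ∑' q : {q : Σ v : V, G.Walk o v // q.2.length = t ∧ q.2.IsPath}, f q.1.1 =
      ∑' v : {v | G.dist o v = t}, f v := by
  let e : {q : Σ v : V, G.Walk o v // q.2.length = t ∧ q.2.IsPath} → {v | G.dist o v = t} :=
    fun q ↦ ⟨q.1.1, (hG.length_eq_dist q.2.2).symm.trans q.2.1⟩
  have he : Function.Bijective e := by
    constructor
    · rintro ⟨⟨v, p⟩, hp⟩ ⟨⟨w, q⟩, hq⟩ h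
      obtain rfl : v = w := congrArg Subtype.val h
      obtain rfl := (hG.existsUnique_path o v).unique hp.2 hq.2
      rfl
    · rintro ⟨v, rfl⟩
      obtain ⟨p, hp, hpd⟩ := hG.connected.exists_path_of_dist o v
      exact ⟨⟨⟨v, p⟩, hpd, hp⟩, rfl⟩
  exact (Equiv.ofBijective e he).tsum_eq fun v : {v | G.dist o v = t} ↦ f v

theorem IsTree.card_parents [G.LocallyFinite] (hG : G.IsTree) {o w : V} {k : ℕ}
    (hw : G.dist o w = k + 1) : {v ∈ G.neighborFinset w | G.dist o v = k}.card = 1 := by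
  obtain ⟨p, hp, hpd⟩ := hG.connected.exists_path_of_dist o w
  have key : ∀ v, G.Adj w v → G.dist o v = k → v = p.penultimate := by
    intro v hv hvk
    obtain ⟨q, hq⟩ := hG.connected.exists_walk_length_eq_dist o v
    have hqp : (q.concat hv.symm).IsPath :=
      Walk.isPath_of_length_eq_dist _ (by rw [Walk.length_concat, hq, hw, hvk])
    rw [(hG.existsUnique_path o w).unique hp hqp, Walk.penultimate_concat]
  have hnil : ¬ p.Nil := by rw [← Walk.length_eq_zero_iff]; omega
  have hadj := (p.adj_penultimate hnil).symm
  have hdist : G.dist o p.penultimate = k := by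
    have h1 := dist_le p.dropLast
    have h2 : p.dropLast.length = p.length - 1 := by simp
    have h3 := hG.dist_eq_dist_add_one_of_adj o hadj
    omega
  rw [Finset.card_eq_one]
  refine ⟨p.penultimate, Finset.ext fun v ↦ ?_⟩
  simp only [Finset.mem_filter, mem_neighborFinset, Finset.mem_singleton]
  exact ⟨fun h ↦ key v h.1 h.2, by rintro rfl; exact ⟨hadj, hdist⟩⟩

theorem IsTree.neighborSum_eq [G.LocallyFinite] (hG : G.IsTree) {o v : V} {k : ℕ}
    (hv : G.dist o v = k + 1) (f : V → ℝ) :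
    G.neighborSum f v = ∑ w ∈ G.neighborFinset v with G.dist o w = k + 2, f w +
      ∑ w ∈ G.neighborFinset v with G.dist o w = k, f w := by
  rw [neighborSum, ← Finset.sum_filter_add_sum_filter_not _ (fun w ↦ G.dist o w = k + 2)]
  congr 2
  refine Finset.filter_congr fun w hw ↦ ?_
  have := hG.dist_eq_dist_add_one_of_adj o ((G.mem_neighborFinset v w).1 hw)
  omega

theorem filter_neighborFinset_dist_eq_one [G.LocallyFinite] (o : V) :
    {w ∈ G.neighborFinset o | G.dist o w = 1} = G.neighborFinset o :=
  Finset.filter_true_of_mem fun w hw ↦ dist_eq_one_iff_adj.2 ((G.mem_neighborFinset o w).1 hw)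

theorem IsTree.card_children [G.LocallyFinite] (hG : G.IsTree) {o w : V} {k : ℕ}
    (hw : G.dist o w = k + 1) :
    {v ∈ G.neighborFinset w | G.dist o v = k + 2}.card + 1 = G.degree w := by
  have h := hG.neighborSum_eq hw (fun _ ↦ 1)
  simp only [neighborSum, Finset.sum_const, nsmul_eq_mul, mul_one, hG.card_parents hw,
    card_neighborFinset_eq_degree] at h
  exact_mod_cast h.symm

/-- The sum of a function over the sphere of radius `t` around `o`. -/
noncomputable def sphereSum [G.LocallyFinite] (hG : G.IsTree) (o : V) (f : V → ℝ) (t : ℕ) : ℝ :=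
  ∑ v ∈ (G.finite_dist_eq hG.connected o t).toFinset, f v

theorem IsTree.tsum_path_eq_sphereSum [G.LocallyFinite] (hG : G.IsTree) (o : V) (f : V → ℝ)
    (t : ℕ) : ∑' q : {q : Σ v : V, G.Walk o v // q.2.length = t ∧ q.2.IsPath}, f q.1.1 =
      sphereSum hG o f t := by
  rw [hG.tsum_path_length_eq, sphereSum, ← Finset.tsum_subtype', Set.Finite.coe_toFinset]

theorem sphereSum_zero [G.LocallyFinite] (hG : G.IsTree) (o : V) (f : V → ℝ) :
    sphereSum hG o f 0 = f o := by
  have : (G.finite_dist_eq hG.connected o 0).toFinset = {o} := by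
    ext v; simp [hG.connected.dist_eq_zero_iff, eq_comm]
  rw [sphereSum, this, Finset.sum_singleton]

theorem sphereSum_filter_comm [G.LocallyFinite] (hG : G.IsTree) (o : V) (f : V → ℝ) {i j m : ℕ}
    (hm : ∀ w, G.dist o w = j → {v ∈ G.neighborFinset w | G.dist o v = i}.card = m) :
    sphereSum hG o (fun v ↦ ∑ w ∈ G.neighborFinset v with G.dist o w = j, f w) i =
      m * sphereSum hG o f j := by
  unfold sphereSum
  rw [Finset.sum_comm' (t' := (G.finite_dist_eq hG.connected o j).toFinset)
    (s' := fun w ↦ {v ∈ G.neighborFinset w | G.dist o v = i}), Finset.mul_sum]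
  · refine Finset.sum_congr rfl fun w hw ↦ ?_
    rw [Finset.sum_const, hm w (by simpa using hw), nsmul_eq_mul]
  · intro v w
    simp [G.adj_comm v w]
    tauto

theorem sphereSum_neighborSum_zero [G.LocallyFinite] (hG : G.IsTree) (o : V) (f : V → ℝ) :
    sphereSum hG o (G.neighborSum f) 0 = sphereSum hG o f 1 := by
  have := sphereSum_filter_comm hG o f (i := 0) (j := 1) fun w hw ↦ hG.card_parents hw
  rw [Nat.cast_one, one_mul] at this
  rw [← this, sphereSum_zero, sphereSum_zero, filter_neighborFinset_dist_eq_one, neighborSum]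

theorem sphereSum_neighborSum_succ [G.LocallyFinite] (hG : G.IsTree) (o : V) (f : V → ℝ) {q : ℕ}
    (hreg : G.IsRegularOfDegree (q + 1)) (k : ℕ) :
    sphereSum hG o (G.neighborSum f) (k + 1) =
      sphereSum hG o f (k + 2) + (if k = 0 then (q : ℝ) + 1 else q) * sphereSum hG o f k := by
  have h1 := sphereSum_filter_comm hG o f (i := k + 1) (j := k + 2) fun w hw ↦ hG.card_parents hw
  have h2 := sphereSum_filter_comm hG o f (i := k + 1) (j := k)
    (m := if k = 0 then q + 1 else q) fun w hw ↦ by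
      cases k with
      | zero =>
        obtain rfl := hG.connected.dist_eq_zero_iff.1 hw
        simp [filter_neighborFinset_dist_eq_one, hreg.degree_eq]
      | succ k => simpa [hreg.degree_eq] using hG.card_children hw
  push_cast at h1 h2
  rw [← h2, ← one_mul (sphereSum hG o f (k + 2)), ← h1]
  simp only [sphereSum, ← Finset.sum_add_distrib]
  exact Finset.sum_congr rfl fun v hv ↦ hG.neighborSum_eq (by simpa using hv) f

theorem iterate_neighborSum_eq [G.LocallyFinite] (hG : G.IsTree) (o : V) {q : ℕ}
    (hreg : G.IsRegularOfDegree (q + 1)) (t : ℕ) (f : V → ℝ) :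
    G.neighborSum^[t] f o =
      ∑ k ∈ Finset.range (t + 1), treeWalkCount q t k * sphereSum hG o f k := by
  induction t generalizing f with
  | zero => simp [treeWalkCount, sphereSum_zero]
  | succ t ih =>
    have hz : ∀ k, t < k → treeWalkCount q t k = 0 := fun k ↦ treeWalkCount.eq_zero_of_lt q
    rw [Function.iterate_succ_apply, ih, Finset.sum_range_succ', Finset.sum_range_succ' _ (t + 1)]
    simp only [sphereSum_neighborSum_zero, sphereSum_neighborSum_succ hG o f hreg, treeWalkCount,
      mul_add, add_mul, Finset.sum_add_distrib]
    rw [Finset.sum_range_succ' (fun k ↦ treeWalkCount q t k * sphereSum hG o f (k + 1))]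
    have h : ∑ k ∈ Finset.range t, treeWalkCount q t (k + 1) *
          ((if k = 0 then (q : ℝ) + 1 else q) * sphereSum hG o f k) =
        ∑ k ∈ Finset.range (t + 2), treeWalkCount q t (k + 1) *
          ((if k = 0 then (q : ℝ) + 1 else q) * sphereSum hG o f k) := by
      simp [Finset.sum_range_succ, hz]
    rw [h, Finset.sum_range_succ']
    simp only [Nat.succ_ne_zero, if_false, if_true]
    have h' : ∀ k, treeWalkCount q t (k + 1 + 1) * (q * sphereSum hG o f (k + 1)) =
        q * treeWalkCount q t (k + 2) * sphereSum hG o f (k + 1) := fun k ↦ by ring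
    simp only [h', zero_add]
    ring

end SimpleGraph

/-- Extended cogrowth formula for nonnegative functions on the `d`-regular tree:
with `a_t(f)` the sum of `f` over endpoints of non-backtracking walks (= paths, in a tree)
of length `t` from the root `o`, and `b_t(f)` the analogous sum over all walks of length `t`,
if `α(f) = limsup a_t(f)^{1/t} < ∞` (i.e. the sequence is bounded above), then
`limsup b_t(f)^{1/t} = g_d(α(f))`. -/
theorem extended_cogrowth_formula_functions (d : ℕ) (hd : 3 ≤ d) {V : Type*}
    (G : SimpleGraph V) [G.LocallyFinite] (hreg : G.IsRegularOfDegree d)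
    (hconn : G.Connected) (hacyc : G.IsAcyclic) (o : V)
    (f : V → ℝ) (hf : ∀ v, 0 ≤ f v) (hf0 : f ≠ 0) :
    ∀ a b : ℕ → ℝ,
      (∀ t, a t = ∑' q : {q : Σ v : V, G.Walk o v // q.2.length = t ∧ q.2.IsPath},
          f q.1.1) →
      (∀ t, b t = ∑' q : {q : Σ v : V, G.Walk o v // q.2.length = t}, f q.1.1) →
      ∀ α : ℝ, α = Filter.limsup (fun t : ℕ => (a t) ^ ((1 : ℝ) / t)) Filter.atTop →
      Filter.IsBoundedUnder (· ≤ ·) Filter.atTop (fun t : ℕ => (a t) ^ ((1 : ℝ) / t)) →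
      Filter.limsup (fun t : ℕ => (b t) ^ ((1 : ℝ) / t)) Filter.atTop =
        (if α ≤ Real.sqrt ((d : ℝ) - 1) then 2 * Real.sqrt ((d : ℝ) - 1)
         else α + ((d : ℝ) - 1) / α) := by
  intro a b ha hb α hα hbdd
  have hG : G.IsTree := ⟨hconn, hacyc⟩
  obtain ⟨q, rfl⟩ : ∃ q, d = q + 1 := ⟨d - 1, by omega⟩
  have hq : (1 : ℝ) < q := by exact_mod_cast (by omega : 1 < q)
  have ha' : ∀ t, a t = SimpleGraph.sphereSum hG o f t := fun t ↦ by
    rw [ha, hG.tsum_path_eq_sphereSum]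
  obtain ⟨v, hv⟩ := Function.ne_iff.1 hf0
  have hv0 : 0 < a (G.dist o v) := by
    rw [ha']
    exact Finset.sum_pos' (fun w _ ↦ hf w) ⟨v, by simp, (hf v).lt_of_ne' hv⟩
  have hab : ∀ t, b t = ∑ k ∈ Finset.range (t + 1), treeWalkCount q t k * a k := fun t ↦ by
    simp only [hb, G.tsum_walk_length_eq, SimpleGraph.iterate_neighborSum_eq hG o hreg, ha']
  rw [Nat.cast_add, Nat.cast_one, add_sub_cancel_right]
  exact limsup_rpow_inv_of_eq_sum_treeWalkCount hq
    (fun t ↦ by rw [ha']; exact Finset.sum_nonneg fun w _ ↦ hf w) hv0 hab hbdd hα
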